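/- Let x̄ ∈ M_c be biactive, let SNO-LICQ hold at x̄, and suppose x̄ is T-stationary with multipliers λ_{1,i}, λ_{2,i}, i.e., ∇f(x̄) = Σ_{i=1}^m λ_{1,i}∇F_{1,i}(x̄) + λ_{2,i}∇F_{2,i}(x̄) and λ_{1,i}·λ_{2,i} ≥ 0 for all i. Then −∇f(x̄) ∉ N_{M_c}(x̄) (x̄ is not limiting-normal stationary) if and only if x̄ is a regular saddle point of first order, i.e., there exists an index i with λ_{1,i} < 0 and λ_{2,i} < 0. -/

import Mathlib

open Filter Topology
open scoped RealInnerProductSpace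

noncomputable section

/-- Tangent (Bouligand) cone: w ∈ T_M(x) iff there are x_k ∈ M, x_k → x, τ_k ↓ 0
with (x_k - x)/τ_k → w. -/
def tangentCone {n : ℕ} (M : Set (EuclideanSpace ℝ (Fin n))) (x : EuclideanSpace ℝ (Fin n)) :
    Set (EuclideanSpace ℝ (Fin n)) :=
  {w | ∃ (xs : ℕ → EuclideanSpace ℝ (Fin n)) (τ : ℕ → ℝ),
    (∀ k, xs k ∈ M) ∧ Tendsto xs atTop (𝓝 x) ∧
    (∀ k, 0 < τ k) ∧ Tendsto τ atTop (𝓝 0) ∧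
    Tendsto (fun k => (τ k)⁻¹ • (xs k - x)) atTop (𝓝 w)}

/-- Fréchet normal cone: v with ⟨v, w⟩ ≤ 0 for all tangent directions w. -/
def frechetNormalCone {n : ℕ} (M : Set (EuclideanSpace ℝ (Fin n)))
    (x : EuclideanSpace ℝ (Fin n)) : Set (EuclideanSpace ℝ (Fin n)) :=
  {v | ∀ w ∈ tangentCone M x, ⟪v, w⟫ ≤ 0}

/-- Mordukhovich (limiting) normal cone. -/
def limitingNormalCone {n : ℕ} (M : Set (EuclideanSpace ℝ (Fin n)))
    (x : EuclideanSpace ℝ (Fin n)) : Set (EuclideanSpace ℝ (Fin n)) :=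
  {v | ∃ (xs vs : ℕ → EuclideanSpace ℝ (Fin n)),
    (∀ k, xs k ∈ M) ∧ Tendsto xs atTop (𝓝 x) ∧
    (∀ k, vs k ∈ frechetNormalCone M (xs k)) ∧ Tendsto vs atTop (𝓝 v)}

/-- Clarke normal cone: closed convex hull of the limiting normal cone. -/
def clarkeNormalCone {n : ℕ} (M : Set (EuclideanSpace ℝ (Fin n)))
    (x : EuclideanSpace ℝ (Fin n)) : Set (EuclideanSpace ℝ (Fin n)) :=
  closure (convexHull ℝ (limitingNormalCone M x))

/-- The MPCC feasible set. -/
def MpccSet {n m : ℕ} (F1 F2 : Fin m → EuclideanSpace ℝ (Fin n) → ℝ) :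
    Set (EuclideanSpace ℝ (Fin n)) :=
  {y | ∀ i, F1 i y * F2 i y = 0 ∧ 0 ≤ F1 i y ∧ 0 ≤ F2 i y}

/-- If the gradients of finitely many `C¹` functions are linearly independent at `x`, then through
every point `y` near `x` there is a curve along which these functions change with prescribed
constant rates `d`; its initial velocity depends continuously on `y`. -/
theorem exists_curve_of_linearIndependent_gradient {n : ℕ} {ι : Type*} [Fintype ι]
    (F : ι → EuclideanSpace ℝ (Fin n) → ℝ) (hF : ∀ i, ContDiff ℝ 1 (F i))
    (x : EuclideanSpace ℝ (Fin n)) (hli : LinearIndependent ℝ fun i => gradient (F i) x)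
    (d : ι → ℝ) :
    ∃ W : EuclideanSpace ℝ (Fin n) → EuclideanSpace ℝ (Fin n), ContinuousAt W x ∧
      (∀ j, ⟪gradient (F j) x, W x⟫ = d j) ∧
      ∀ᶠ y in 𝓝 x, ∃ c : ℝ → EuclideanSpace ℝ (Fin n), c 0 = y ∧ HasDerivAt c (W y) 0 ∧
        ∀ᶠ t in 𝓝 (0 : ℝ), ∀ j, F j (c t) = F j y + t * d j := by
  have hG : ContDiff ℝ 1 fun y i => F i y := contDiff_pi.2 hF
  set G : EuclideanSpace ℝ (Fin n) → ι → ℝ := fun y i => F i y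
  have hD (w : EuclideanSpace ℝ (Fin n)) (i : ι) : fderiv ℝ G x w i = ⟪gradient (F i) x, w⟫ := by
    have h := hasFDerivAt_pi.2 fun j => ((hF j).differentiable one_ne_zero x).hasFDerivAt
    rw [inner_gradient_left, HasFDerivAt.fderiv h]
    rfl
  let A : (ι → ℝ) →L[ℝ] EuclideanSpace ℝ (Fin n) :=
    LinearMap.toContinuousLinearMap (Fintype.linearCombination ℝ fun i => gradient (F i) x)
  have hA (z : ι → ℝ) : A z = ∑ i, z i • gradient (F i) x := rfl
  have hunit : IsUnit (fderiv ℝ G x ∘L A) := by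
    have hinj : Function.Injective (fderiv ℝ G x ∘L A : (ι → ℝ) →L[ℝ] (ι → ℝ)) := by
      refine (injective_iff_map_eq_zero _).2 fun z hz => ?_
      have h0 : A z = 0 := by
        rw [← inner_self_eq_zero (𝕜 := ℝ)]
        conv_lhs => rw [hA z, sum_inner]
        refine Finset.sum_eq_zero fun i _ => ?_
        rw [← hA z, inner_smul_left, ← hD, ← ContinuousLinearMap.comp_apply, hz]
        simp
      exact funext fun i => Fintype.linearIndependent_iff.1 hli z h0 i
    exact ContinuousLinearMap.isUnit_iff_bijective.2
      ⟨hinj, LinearMap.injective_iff_surjective.1 hinj⟩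
  have hcont : ContinuousAt (fun y => fderiv ℝ G y ∘L A) x :=
    ((hG.continuous_fderiv one_ne_zero).clm_comp continuous_const).continuousAt
  refine ⟨fun y => A (Ring.inverse (fderiv ℝ G y ∘L A) d), ?_, fun j => ?_, ?_⟩
  · obtain ⟨u, hu⟩ := hunit
    have h1 : ContinuousAt (fun y => Ring.inverse (fderiv ℝ G y ∘L A)) x :=
      ContinuousAt.comp (g := Ring.inverse) (by rw [← hu]; exact NormedRing.inverse_continuousAt u)
        hcont
    exact A.continuous.continuousAt.comp (h1.clm_apply continuousAt_const)
  · rw [← hD]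
    have := Ring.mul_inverse_cancel _ hunit
    exact congrFun (congrArg (fun L : (ι → ℝ) →L[ℝ] (ι → ℝ) => L d) this) j
  · filter_upwards [hcont.eventually (Units.isOpen.mem_nhds hunit)] with y hy
    obtain ⟨u, hu⟩ := hy
    let e : (ι → ℝ) ≃L[ℝ] (ι → ℝ) := ContinuousLinearEquiv.ofUnit u
    have hH : HasStrictFDerivAt (fun z => G (y + A z)) (e : (ι → ℝ) →L[ℝ] (ι → ℝ)) 0 := by
      have h1 : HasStrictFDerivAt G (fderiv ℝ G y) (y + A 0) := by
        simpa using hG.contDiffAt.hasStrictFDerivAt one_ne_zero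
      have h2 : HasStrictFDerivAt (fun z => y + A z) A 0 := A.hasStrictFDerivAt.const_add y
      have h3 := h1.comp (0 : ι → ℝ) h2
      rw [← hu] at h3
      exact h3
    have hline : HasDerivAt (fun t : ℝ => G y + t • d) d 0 := by
      simpa using ((hasDerivAt_id (0 : ℝ)).smul_const d).const_add (G y)
    have hline0 : G y + (0 : ℝ) • d = G (y + A 0) := by simp
    refine ⟨fun t => y + A (hH.localInverse _ e 0 (G y + t • d)), ?_, ?_, ?_⟩
    · have h1 := hH.localInverse_apply_image
      rw [← hline0] at h1
      change y + A (hH.localInverse _ e 0 (G y + (0 : ℝ) • d)) = y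
      rw [h1, map_zero, add_zero]
    · have h1 := hH.to_localInverse.hasFDerivAt
      simp only [← hline0] at h1
      have h2 := (A.hasFDerivAt.comp_hasDerivAt (0 : ℝ) (h1.comp_hasDerivAt (0 : ℝ) hline)).const_add y
      rw [← hu, Ring.inverse_unit]
      exact h2
    · have h1 := hH.eventually_right_inverse
      rw [← hline0] at h1
      filter_upwards [hline.continuousAt.eventually h1] with t ht j
      exact congrFun ht j

/-- The initial velocity of a curve that starts at `y` and then stays in `M` is tangent. -/
theorem mem_tangentCone_of_hasDerivAt {n : ℕ} {M : Set (EuclideanSpace ℝ (Fin n))}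
    {c : ℝ → EuclideanSpace ℝ (Fin n)} {w : EuclideanSpace ℝ (Fin n)}
    (hc : HasDerivAt c w 0) (hM : ∀ᶠ t in 𝓝[>] (0 : ℝ), c t ∈ M) : w ∈ tangentCone M (c 0) := by
  obtain ⟨τ, hτ⟩ := exists_seq_tendsto (𝓝[>] (0 : ℝ))
  obtain ⟨N, hN⟩ := eventually_atTop.1 (hτ.eventually (hM.and self_mem_nhdsWithin))
  have hτN : Tendsto (fun k => τ (k + N)) atTop (𝓝[>] 0) := (tendsto_add_atTop_iff_nat N).2 hτ
  have hτ0 := tendsto_nhds_of_tendsto_nhdsWithin hτN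
  refine ⟨fun k => c (τ (k + N)), fun k => τ (k + N), fun k => (hN _ (by lia)).1,
    hc.continuousAt.tendsto.comp hτ0, fun k => (hN _ (by lia)).2, hτ0, ?_⟩
  simpa [Function.comp_def] using hc.tendsto_slope_zero_right.comp hτN

/-- The derivative along a tangent direction is a limit of difference quotients within `M`. -/
theorem exists_tendsto_inner_gradient_of_mem_tangentCone {n : ℕ}
    {M : Set (EuclideanSpace ℝ (Fin n))} {g : EuclideanSpace ℝ (Fin n) → ℝ}
    {y w : EuclideanSpace ℝ (Fin n)} (hg : DifferentiableAt ℝ g y) (hw : w ∈ tangentCone M y) :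
    ∃ (xs : ℕ → EuclideanSpace ℝ (Fin n)) (τ : ℕ → ℝ), (∀ k, xs k ∈ M) ∧
      Tendsto xs atTop (𝓝 y) ∧ (∀ k, 0 < τ k) ∧
      Tendsto (fun k => (τ k)⁻¹ * (g (xs k) - g y)) atTop (𝓝 ⟪gradient g y, w⟫) := by
  obtain ⟨xs, τ, hxM, hx, hτ, -, hlim⟩ := hw
  refine ⟨xs, τ, hxM, hx, hτ, ?_⟩
  have h := hg.hasFDerivAt.hasFDerivWithinAt (s := Set.univ) |>.lim
    (d := fun k => xs k - y) (tendsto_sub_nhds_zero_iff.2 hx) (by simp) hlim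
  simpa [inner_gradient_left] using h

/-- A function that attains a local minimum over `M` at `y` does not decrease to first order
along tangent directions. -/
theorem inner_gradient_nonneg_of_mem_tangentCone {n : ℕ} {M : Set (EuclideanSpace ℝ (Fin n))}
    {g : EuclideanSpace ℝ (Fin n) → ℝ} {y w : EuclideanSpace ℝ (Fin n)}
    (hg : DifferentiableAt ℝ g y) (hw : w ∈ tangentCone M y)
    (hM : ∀ᶠ z in 𝓝 y, z ∈ M → g y ≤ g z) : 0 ≤ ⟪gradient g y, w⟫ := by
  obtain ⟨xs, τ, hxM, hx, hτ, hlim⟩ := exists_tendsto_inner_gradient_of_mem_tangentCone hg hw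
  refine ge_of_tendsto hlim ((hx.eventually hM).mono fun k hk => ?_)
  exact mul_nonneg (inv_nonneg.2 (hτ k).le) (sub_nonneg.2 (hk (hxM k)))

/-- A function that is constant on `M` near `y` has zero derivative along tangent directions. -/
theorem inner_gradient_eq_zero_of_mem_tangentCone {n : ℕ} {M : Set (EuclideanSpace ℝ (Fin n))}
    {g : EuclideanSpace ℝ (Fin n) → ℝ} {y w : EuclideanSpace ℝ (Fin n)}
    (hg : DifferentiableAt ℝ g y) (hw : w ∈ tangentCone M y)
    (hM : ∀ᶠ z in 𝓝 y, z ∈ M → g z = g y) : ⟪gradient g y, w⟫ = 0 := by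
  obtain ⟨xs, τ, hxM, hx, -, hlim⟩ := exists_tendsto_inner_gradient_of_mem_tangentCone hg hw
  refine tendsto_nhds_unique hlim (tendsto_nhds_of_eventually_eq ?_)
  exact (hx.eventually hM).mono fun k hk => by simp [hk (hxM k)]

/-- The gradient of a `C¹` function is continuous. -/
theorem ContDiff.continuous_gradient {n : ℕ} {g : EuclideanSpace ℝ (Fin n) → ℝ}
    (hg : ContDiff ℝ 1 g) : Continuous (gradient g) :=
  (InnerProductSpace.toDual ℝ _).symm.continuous.comp (hg.continuous_fderiv one_ne_zero)

/-- A T-stationary point of MPCC (biactive, SNO-LICQ) fails to be limiting-normal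
stationary iff it is a regular saddle point of first order. -/
theorem mpcc_T_not_limiting_iff_regular_saddle {n m : ℕ}
    (f : EuclideanSpace ℝ (Fin n) → ℝ) (F1 F2 : Fin m → EuclideanSpace ℝ (Fin n) → ℝ)
    (hf : ContDiff ℝ 1 f) (hF1 : ∀ i, ContDiff ℝ 1 (F1 i)) (hF2 : ∀ i, ContDiff ℝ 1 (F2 i))
    (x : EuclideanSpace ℝ (Fin n))
    (hbi : ∀ i, F1 i x = 0 ∧ F2 i x = 0)
    (hLICQ : LinearIndependent ℝ
      (Sum.elim (fun i => gradient (F1 i) x) (fun i => gradient (F2 i) x)))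
    (l1 l2 : Fin m → ℝ) (hsign : ∀ i, 0 ≤ l1 i * l2 i)
    (hT : gradient f x = ∑ i, (l1 i • gradient (F1 i) x + l2 i • gradient (F2 i) x)) :
    -gradient f x ∉ limitingNormalCone (MpccSet F1 F2) x ↔
      ∃ i, l1 i < 0 ∧ l2 i < 0 := by
  have hF : ∀ i, ContDiff ℝ 1 (Sum.elim F1 F2 i) := Sum.rec hF1 hF2
  have hli : LinearIndependent ℝ fun i => gradient (Sum.elim F1 F2 i) x := by
    convert hLICQ using 1
    ext1 i
    cases i <;> rfl
  constructor
  · contrapose!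
    intro hneg
    let d : Fin m ⊕ Fin m → ℝ :=
      Sum.elim (fun i => if l2 i < 0 then 1 else 0) (fun i => if l1 i < 0 then 1 else 0)
    obtain ⟨W, -, -, hW⟩ := exists_curve_of_linearIndependent_gradient _ hF x hli d
    obtain ⟨c, hc0, hc, hFc⟩ := hW.self_of_nhds
    obtain ⟨τ, hτ⟩ := exists_seq_tendsto (𝓝[>] (0 : ℝ))
    obtain ⟨N, hN⟩ := eventually_atTop.1
      (hτ.eventually ((hFc.filter_mono nhdsWithin_le_nhds).and self_mem_nhdsWithin))
    have hτ0 : Tendsto (fun k => τ (k + N)) atTop (𝓝 0) :=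
      tendsto_nhds_of_tendsto_nhdsWithin ((tendsto_add_atTop_iff_nat N).2 hτ)
    have hpos (k : ℕ) : 0 < τ (k + N) := (hN _ (by lia)).2
    have hv1 (k : ℕ) (i : Fin m) : F1 i (c (τ (k + N))) = if l2 i < 0 then τ (k + N) else 0 := by
      simpa [d, hbi] using (hN (k + N) (by lia)).1 (Sum.inl i)
    have hv2 (k : ℕ) (i : Fin m) : F2 i (c (τ (k + N))) = if l1 i < 0 then τ (k + N) else 0 := by
      simpa [d, hbi] using (hN (k + N) (by lia)).1 (Sum.inr i)
    have hx : Tendsto (fun k => c (τ (k + N))) atTop (𝓝 x) := by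
      rw [← hc0]
      exact hc.continuousAt.tendsto.comp hτ0
    let v : EuclideanSpace ℝ (Fin n) → EuclideanSpace ℝ (Fin n) := fun y =>
      -∑ i, (l1 i • gradient (F1 i) y + l2 i • gradient (F2 i) y)
    have hvcont : Continuous v := by
      refine Continuous.neg (continuous_finsetSum _ fun i _ => Continuous.add ?_ ?_)
      · exact (hF1 i).continuous_gradient.const_smul (l1 i)
      · exact (hF2 i).continuous_gradient.const_smul (l2 i)
    refine ⟨fun k => c (τ (k + N)), fun k => v (c (τ (k + N))), fun k i => ?_, hx,
      fun k w hw => ?_, ?_⟩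
    · rw [hv1, hv2]
      have := hneg i
      have := hpos k
      split_ifs <;> grind
    · have hnonneg : 0 ≤ ∑ i, (l1 i * ⟪gradient (F1 i) (c (τ (k + N))), w⟫ +
          l2 i * ⟪gradient (F2 i) (c (τ (k + N))), w⟫) := by
        refine Finset.sum_nonneg fun i _ => ?_
        have hd1 := (hF1 i).differentiable one_ne_zero (c (τ (k + N)))
        have hd2 := (hF2 i).differentiable one_ne_zero (c (τ (k + N)))
        have h1 : 0 ≤ l2 i → 0 ≤ ⟪gradient (F1 i) (c (τ (k + N))), w⟫ := fun h =>
          inner_gradient_nonneg_of_mem_tangentCone hd1 hw <| .of_forall fun z hz => by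
            rw [hv1, if_neg h.not_gt]
            exact (hz i).2.1
        have h2 : 0 ≤ l1 i → 0 ≤ ⟪gradient (F2 i) (c (τ (k + N))), w⟫ := fun h =>
          inner_gradient_nonneg_of_mem_tangentCone hd2 hw <| .of_forall fun z hz => by
            rw [hv2, if_neg h.not_gt]
            exact (hz i).2.2
        have h3 : l1 i < 0 → ⟪gradient (F1 i) (c (τ (k + N))), w⟫ = 0 := fun h => by
          refine inner_gradient_eq_zero_of_mem_tangentCone hd1 hw ?_
          filter_upwards [hd2.continuousAt.eventually_ne (y := 0) (by simp [hv2, h, (hpos k).ne'])]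
            with z hz hzM
          rw [hv1, if_neg (hneg i h).not_gt]
          exact (mul_eq_zero.1 (hzM i).1).resolve_right hz
        have h4 : l2 i < 0 → ⟪gradient (F2 i) (c (τ (k + N))), w⟫ = 0 := fun h => by
          refine inner_gradient_eq_zero_of_mem_tangentCone hd2 hw ?_
          filter_upwards [hd1.continuousAt.eventually_ne (y := 0) (by simp [hv1, h, (hpos k).ne'])]
            with z hz hzM
          rw [hv2, if_neg fun h' => (hneg i h').not_gt h]
          exact (mul_eq_zero.1 (hzM i).1).resolve_left hz
        rcases lt_or_ge (l1 i) 0 with h | h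
        · have h0 : l2 i = 0 := by nlinarith [hneg i h, hsign i]
          simp [h3 h, h0]
        · rcases lt_or_ge (l2 i) 0 with h' | h'
          · have h0 : l1 i = 0 := by nlinarith [hsign i]
            simp [h4 h', h0]
          · exact add_nonneg (mul_nonneg h (h1 h')) (mul_nonneg h' (h2 h))
      simpa [v, sum_inner, inner_add_left, inner_smul_left] using hnonneg
    · rw [hT]
      exact hvcont.continuousAt.tendsto.comp hx
  · rintro ⟨i, hl1, hl2⟩ ⟨xs, vs, hxM, hx, hv, hvlim⟩
    obtain ⟨W1, hW1, hW1x, hc1⟩ :=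
      exists_curve_of_linearIndependent_gradient _ hF x hli (Pi.single (Sum.inl i) 1)
    obtain ⟨W2, hW2, hW2x, hc2⟩ :=
      exists_curve_of_linearIndependent_gradient _ hF x hli (Pi.single (Sum.inr i) 1)
    have hlim1 : 0 < ⟪-gradient f x, W1 x⟫ := by
      have h1 (j : Fin m) := hW1x (Sum.inl j)
      have h2 (j : Fin m) := hW1x (Sum.inr j)
      simp only [Sum.elim_inl, Sum.elim_inr] at h1 h2
      simpa [hT, sum_inner, inner_add_left, inner_smul_left, h1, h2, Pi.single_apply] using hl1
    have hlim2 : 0 < ⟪-gradient f x, W2 x⟫ := by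
      have h1 (j : Fin m) := hW2x (Sum.inl j)
      have h2 (j : Fin m) := hW2x (Sum.inr j)
      simp only [Sum.elim_inl, Sum.elim_inr] at h1 h2
      simpa [hT, sum_inner, inner_add_left, inner_smul_left, h1, h2, Pi.single_apply] using hl2
    have hev1 := (hvlim.inner (hW1.tendsto.comp hx)).eventually_const_lt hlim1
    have hev2 := (hvlim.inner (hW2.tendsto.comp hx)).eventually_const_lt hlim2
    obtain ⟨k, hk1, hk2, ⟨c1, hc10, hc1', hFc1⟩, c2, hc20, hc2', hFc2⟩ :=
      (hev1.and (hev2.and ((hx.eventually hc1).and (hx.eventually hc2)))).exists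
    rcases mul_eq_zero.1 (hxM k i).1 with h0 | h0
    · refine hk2.not_ge (hv k _ ?_)
      have := mem_tangentCone_of_hasDerivAt (M := MpccSet F1 F2) hc2' ?_
      · rwa [hc20] at this
      filter_upwards [nhdsWithin_le_nhds hFc2, self_mem_nhdsWithin] with t ht (ht0 : 0 < t) j
      have e1 := ht (Sum.inl j)
      have e2 := ht (Sum.inr j)
      obtain ⟨g1, g2, g3⟩ := hxM k j
      simp only [Sum.elim_inl, Sum.elim_inr, Pi.single_apply] at e1 e2
      rw [e1, e2]
      by_cases hj : j = i
      · subst hj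
        simp [h0]
        positivity
      · simp [hj, g1, g2, g3]
    · refine hk1.not_ge (hv k _ ?_)
      have := mem_tangentCone_of_hasDerivAt (M := MpccSet F1 F2) hc1' ?_
      · rwa [hc10] at this
      filter_upwards [nhdsWithin_le_nhds hFc1, self_mem_nhdsWithin] with t ht (ht0 : 0 < t) j
      have e1 := ht (Sum.inl j)
      have e2 := ht (Sum.inr j)
      obtain ⟨g1, g2, g3⟩ := hxM k j
      simp only [Sum.elim_inl, Sum.elim_inr, Pi.single_apply] at e1 e2
      rw [e1, e2]
      by_cases hj : j = i
      · subst hj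
        simp [h0]
        positivity
      · simp [hj, g1, g2, g3]
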